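/- Under the Liouville transformation y with dy/dx = √q and φ(y) = q(x)^{1/4} Ψ(x), if Ψ satisfies Ψ_xx = (1/4 + λ q) Ψ then φ satisfies -φ_yy + U(y) φ = μ φ with μ = -1/(4ω) - λ and U = 1/(4q) + q_yy/(4q) - 3 q_y²/(16 q²) - 1/(4ω), where subscripts y denote derivatives in the new variable. -/

import Mathlib

open Complex

/-- The inverse of a bijection of `ℝ` with positive derivative `d` has derivative `d⁻¹`. -/
lemma hasDerivAt_inverse_of_pos {y yinv d : ℝ → ℝ} (hd : ∀ x, HasDerivAt y (d x) x)
    (hpos : ∀ x, 0 < d x) (hleft : Function.LeftInverse yinv y)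
    (hright : Function.RightInverse yinv y) (x : ℝ) :
    HasDerivAt yinv (d x)⁻¹ (y x) := by
  have hmono : StrictMono y :=
    strictMono_of_deriv_pos fun x => (hd x).deriv.symm ▸ hpos x
  have hcont : Continuous yinv :=
    (hmono.orderIsoOfRightInverse y yinv hright).symm.continuous
  refine HasDerivAt.of_local_left_inverse hcont.continuousAt ?_ (hpos x).ne'
    (Filter.Eventually.of_forall hright)
  rw [hleft x]
  exact hd x

/-- The chain rule `dg/dy = (dy/dx)⁻¹ dg/dx` for a function `g` of the new variable. -/
lemma deriv_comp_eq_of_change_variable {E : Type*} [NormedAddCommGroup E] [NormedSpace ℝ E]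
    {y yinv d : ℝ → ℝ} (hd : ∀ x, HasDerivAt y (d x) x)
    (hpos : ∀ x, 0 < d x) (hleft : Function.LeftInverse yinv y)
    (hright : Function.RightInverse yinv y) {g : ℝ → E} {f f' : ℝ → E}
    (hg : ∀ x, g (y x) = f x) (hf : ∀ x, HasDerivAt f (f' x) x) (x : ℝ) :
    deriv g (y x) = (d x)⁻¹ • f' x := by
  have hgf : g = f ∘ yinv := funext fun s => by
    rw [Function.comp_apply, ← hg, hright s]
  rw [hgf]
  refine HasDerivAt.deriv (HasDerivAt.scomp (y x) ?_
    (hasDerivAt_inverse_of_pos hd hpos hleft hright x))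
  rw [hleft x]
  exact hf x

/-- the Liouville transformation maps the CH spectral problem to a
    standard Sturm-Liouville problem -φ_yy + U φ = μ φ. -/
theorem liouville_transformation
    (ω : ℝ) (hω : 0 < ω)
    (q : ℝ → ℝ) (hq : ContDiff ℝ (⊤ : ℕ∞) q) (hqpos : ∀ x, 0 < q x)
    (lam : ℂ)
    (Ψ : ℝ → ℂ) (hΨ : ContDiff ℝ (⊤ : ℕ∞) Ψ)
    (hΨeq : ∀ x, deriv (deriv Ψ) x = (1/4 + lam * q x) * Ψ x)
    (y yinv : ℝ → ℝ)
    (hyd : ∀ x, HasDerivAt y (Real.sqrt (q x)) x)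
    (hleft : Function.LeftInverse yinv y)
    (hright : Function.RightInverse yinv y)
    (φ : ℝ → ℂ) (hφ : ContDiff ℝ (⊤ : ℕ∞) φ)
    (hrel : ∀ x, φ (y x) = ((q x ^ (1/4 : ℝ) : ℝ) : ℂ) * Ψ x)
    (Qy : ℝ → ℝ) (hQy : ∀ s, Qy s = q (yinv s))
    (U : ℝ → ℝ)
    (hU : ∀ s, U s = 1/(4 * Qy s) + deriv (deriv Qy) s / (4 * Qy s)
        - 3 * (deriv Qy s)^2 / (16 * (Qy s)^2) - 1/(4*ω))
    (μ : ℂ) (hμ : μ = -1/(4*(ω:ℂ)) - lam) :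
    ∀ x : ℝ, -(deriv (deriv φ) (y x)) + (U (y x) : ℂ) * φ (y x) = μ * φ (y x) := by
  -- Everything is expressed through the fourth root `a` of `q`.
  set a : ℝ → ℝ := fun x => q x ^ (1/4 : ℝ) with ha_def
  have ha : ContDiff ℝ (⊤ : ℕ∞) a := hq.rpow_const_of_ne fun x => (hqpos x).ne'
  have hapos : ∀ x, 0 < a x := fun x => Real.rpow_pos_of_pos (hqpos x) _
  have hqa : ∀ x, q x = a x ^ 4 := fun x => by
    rw [ha_def, ← Real.rpow_natCast, ← Real.rpow_mul (hqpos x).le]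
    norm_num
  have hsqrt : ∀ x, Real.sqrt (q x) = a x ^ 2 := fun x => by
    rw [hqa, show a x ^ 4 = (a x ^ 2) ^ 2 by ring, Real.sqrt_sq (by positivity)]
  have hd : ∀ x, HasDerivAt y (a x ^ 2) x := fun x => hsqrt x ▸ hyd x
  have hdpos : ∀ x, 0 < a x ^ 2 := fun x => pow_pos (hapos x) 2
  have ha1 : ∀ x, HasDerivAt a (deriv a x) x := fun x =>
    (ha.differentiable (by simp) x).hasDerivAt
  have ha2 : ∀ x, HasDerivAt (deriv a) (deriv (deriv a) x) x := fun x =>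
    ((contDiff_infty_iff_deriv.1 ha).2.differentiable (by simp) x).hasDerivAt
  have hΨ1 : ∀ x, HasDerivAt Ψ (deriv Ψ x) x := fun x =>
    (hΨ.differentiable (by simp) x).hasDerivAt
  have hΨ2 : ∀ x, HasDerivAt (deriv Ψ) ((1/4 + lam * q x) * Ψ x) x := fun x =>
    hΨeq x ▸ ((contDiff_infty_iff_deriv.1 hΨ).2.differentiable (by simp) x).hasDerivAt
  have hQ1 : ∀ x, deriv Qy (y x) = 4 * a x * deriv a x := fun x => by
    rw [deriv_comp_eq_of_change_variable hd hdpos hleft hright (f := fun x => a x ^ 4)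
      (fun x => by rw [hQy, hleft x, hqa]) (fun x => (ha1 x).pow 4) x]
    have := (hapos x).ne'
    simp only [smul_eq_mul]
    field_simp
    norm_num
    ring
  have hQ2 : ∀ x, deriv (deriv Qy) (y x)
      = (a x ^ 2)⁻¹ * (4 * deriv a x * deriv a x + 4 * a x * deriv (deriv a) x) := fun x =>
    deriv_comp_eq_of_change_variable hd hdpos hleft hright hQ1
      (fun x => ((ha1 x).const_mul 4).mul (ha2 x)) x
  have hrel' : ∀ x, φ (y x) = (a x : ℂ) * Ψ x := hrel
  have hφ1 : ∀ x, deriv φ (y x)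
      = (((a x ^ 2)⁻¹ : ℝ) : ℂ) * (((deriv a x : ℝ) : ℂ) * Ψ x + (a x : ℂ) * deriv Ψ x) := fun x => by
    rw [deriv_comp_eq_of_change_variable hd hdpos hleft hright hrel'
      (fun x => (ha1 x).ofReal_comp.mul (hΨ1 x)) x, Complex.real_smul]
  have hφ2 := deriv_comp_eq_of_change_variable hd hdpos hleft hright hφ1
    (fun x => (((ha1 x).pow 2).inv (hdpos x).ne').ofReal_comp.mul
      (((ha2 x).ofReal_comp.mul (hΨ1 x)).add ((ha1 x).ofReal_comp.mul (hΨ2 x))))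
  intro x
  have hac : (a x : ℂ) ≠ 0 := Complex.ofReal_ne_zero.2 (hapos x).ne'
  have hωc : (ω : ℂ) ≠ 0 := Complex.ofReal_ne_zero.2 hω.ne'
  rw [hφ2, hU, hμ, hQ1, hQ2, hQy, hleft x, hrel', Complex.real_smul, hqa]
  simp only [Pi.pow_apply, Pi.inv_apply]
  push_cast
  field_simp
  ring
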